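/- Let G be a strongly connected simple directed graph on n > 1 vertices, let w ∈ Sp(V), and let 𝒢*_1,…,𝒢*_l be the maximal elements among the principal subsets of 𝒢 with respect to the partial order ≻. Then the sets Co(𝒢*_1),…,Co(𝒢*_l) are pairwise disjoint and 𝔸_G(w) = Co(𝒢*_1) ∪ … ∪ Co(𝒢*_l). -/

import Mathlib

open Matrix Finset
open scoped Classical

noncomputable section

/-- `A` is an infinitesimal stochastic matrix (ISM): all off-diagonal entries are
nonnegative and every row sums to zero. -/
def IsISM {n : ℕ} (A : Matrix (Fin n) (Fin n) ℝ) : Prop :=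
  (∀ i j, i ≠ j → 0 ≤ A i j) ∧ ∀ i, ∑ j, A i j = 0

/-- `A` has the zero pattern prescribed by the digraph with edge relation `E`:
`A i j = 0` whenever `i ≠ j` and `i → j` is not an edge. -/
def InPattern {n : ℕ} (E : Fin n → Fin n → Prop) (A : Matrix (Fin n) (Fin n) ℝ) : Prop :=
  ∀ i j, i ≠ j → ¬ E i j → A i j = 0

/-- `r` is a root of the digraph `E`: every vertex has a directed path to `r`. -/
def IsRootOf {n : ℕ} (E : Fin n → Fin n → Prop) (r : Fin n) : Prop :=
  ∀ i, Relation.ReflTransGen E i r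

/-- The digraph `E` is rooted. -/
def Rooted {n : ℕ} (E : Fin n → Fin n → Prop) : Prop :=
  ∃ r, IsRootOf E r

/-- `w` lies in the standard simplex `Sp[V]`. -/
def MemSimplex {n : ℕ} (w : Fin n → ℝ) : Prop :=
  (∀ i, 0 ≤ w i) ∧ ∑ i, w i = 1

/-- `0` is a simple eigenvalue of `A`: it is a root of multiplicity exactly one of
the characteristic polynomial of `A`. -/
def SimpleZeroEig {n : ℕ} (A : Matrix (Fin n) (Fin n) ℝ) : Prop :=
  Polynomial.rootMultiplicity 0 (Matrix.charpoly A) = 1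

/-- `A ∈ 𝔸_G(w)`: the set of `w`-feasible dynamics. -/
def Feasible {n : ℕ} (E : Fin n → Fin n → Prop) (w : Fin n → ℝ)
    (A : Matrix (Fin n) (Fin n) ℝ) : Prop :=
  IsISM A ∧ InPattern E A ∧ SimpleZeroEig A ∧ Aᵀ *ᵥ w = 0

/-- `S` is a relevant subset of the digraph `E`: it consists of roots and the induced
subgraph on `S` is strongly connected (paths staying inside `S`). -/
def RelevantSubset {n : ℕ} (E : Fin n → Fin n → Prop) (S : Set (Fin n)) : Prop :=
  (∀ i ∈ S, IsRootOf E i) ∧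
    ∀ i ∈ S, ∀ j ∈ S, Relation.ReflTransGen (fun a b => E a b ∧ a ∈ S ∧ b ∈ S) i j

/-- `c` is (the edge relation of) a cycle of the digraph `E`: there are distinct
vertices `v 0, …, v (m+1)` (hence at least two of them), each edge `v t → v (t+1)`
(indices cyclic) is an edge of `E`, and the edges of `c` are exactly these edges. -/
def IsCycleOf {n : ℕ} (E : Fin n → Fin n → Prop) (c : Fin n → Fin n → Prop) : Prop :=
  ∃ (m : ℕ) (v : Fin (m + 2) → Fin n), Function.Injective v ∧
    (∀ t, E (v t) (v (t + 1))) ∧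
    ∀ i j, c i j ↔ ∃ t, v t = i ∧ v (t + 1) = j

/-- The ISM associated with a cycle `c` and the weight vector `w`: off-diagonal
entries are `1 / w j` on the edges of the cycle and `0` otherwise, and the diagonal
entries are chosen so that every row sums to zero. -/
noncomputable def cycleISM {n : ℕ} (w : Fin n → ℝ) (c : Fin n → Fin n → Prop) :
    Matrix (Fin n) (Fin n) ℝ :=
  Matrix.of fun i j =>
    if i = j then -(∑ l ∈ Finset.univ.erase i, if c i l then (w i)⁻¹ else 0)
    else if c i j then (w i)⁻¹ else 0

/-- Given an enumeration `Gc` of the cycles of a digraph on `Fin n`, a set `S` of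
indices of cycles is principal if the digraph whose edge set is the union of the
edge sets of the chosen cycles is strongly connected. -/
def PrincipalSubset {n k : ℕ} (Gc : Fin k → Fin n → Fin n → Prop) (S : Finset (Fin k)) : Prop :=
  ∀ i j : Fin n, Relation.ReflTransGen (fun a b => ∃ s ∈ S, Gc s a b) i j

/-- `Co(𝒢')`: the set of strictly positive linear combinations of the matrices
`C s`, `s ∈ S`. -/
def coOpen {n k : ℕ} (C : Fin k → Matrix (Fin n) (Fin n) ℝ) (S : Finset (Fin k)) :
    Set (Matrix (Fin n) (Fin n) ℝ) :=
  {A | ∃ α : Fin k → ℝ, (∀ s ∈ S, 0 < α s) ∧ A = ∑ s ∈ S, α s • C s}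

/-- A principal subset is maximal (w.r.t. the partial order `𝒢' ≻ 𝒢''` iff
`Co(𝒢') ⊋ Co(𝒢'')`) if no principal subset is strictly above it. -/
def MaximalPrincipal {n k : ℕ} (Gc : Fin k → Fin n → Fin n → Prop)
    (C : Fin k → Matrix (Fin n) (Fin n) ℝ) (S : Finset (Fin k)) : Prop :=
  PrincipalSubset Gc S ∧
    ¬ ∃ S' : Finset (Fin k), PrincipalSubset Gc S' ∧ coOpen C S ⊂ coOpen C S'


namespace IsCycleOf

variable {n : ℕ} {E F c d : Fin n → Fin n → Prop}

lemma edge (h : IsCycleOf E c) {i j : Fin n} (hij : c i j) : E i j := by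
  obtain ⟨m, v, -, hE, hc⟩ := h
  obtain ⟨t, rfl, rfl⟩ := (hc i j).1 hij
  exact hE t

lemma mono (h : IsCycleOf E c) (hEF : ∀ i j, E i j → F i j) : IsCycleOf F c := by
  obtain ⟨m, v, hv, hE, hc⟩ := h
  exact ⟨m, v, hv, fun t => hEF _ _ (hE t), hc⟩

lemma nonempty (h : IsCycleOf E c) : ∃ i j, c i j := by
  obtain ⟨m, v, hv, hE, hc⟩ := h
  exact ⟨v 0, v (0 + 1), (hc _ _).2 ⟨0, rfl, rfl⟩⟩

lemma exists_next (h : IsCycleOf E c) {i j : Fin n} (hij : c i j) : ∃ k, c j k := by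
  obtain ⟨m, v, hv, hE, hc⟩ := h
  obtain ⟨t, rfl, rfl⟩ := (hc i j).1 hij
  exact ⟨v (t + 1 + 1), (hc _ _).2 ⟨t + 1, rfl, rfl⟩⟩

lemma next_unique (h : IsCycleOf E c) {i j k : Fin n} (hij : c i j) (hik : c i k) : j = k := by
  obtain ⟨m, v, hv, hE, hc⟩ := h
  obtain ⟨t, rfl, rfl⟩ := (hc i j).1 hij
  obtain ⟨s, hs, rfl⟩ := (hc _ k).1 hik
  rw [hv hs]

open scoped Fin.CommRing in
/-- No cycle is properly contained in another one. -/
lemma eq_of_subset (hc : IsCycleOf E c) (hd : IsCycleOf F d) (h : ∀ i j, c i j → d i j) :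
    c = d := by
  have hd' := hd
  obtain ⟨i₀, j₀, h₀⟩ := hc.nonempty
  obtain ⟨m, u, hu, -, hdu⟩ := hd
  obtain ⟨a, rfl, rfl⟩ := (hdu _ _).1 (h _ _ h₀)
  have key : ∀ k : ℕ, c (u (a + (k : Fin (m + 2)))) (u (a + (k : Fin (m + 2)) + 1)) := by
    intro k
    induction k with
    | zero => simpa using h₀
    | succ k ih =>
      obtain ⟨z, hz⟩ := hc.exists_next ih
      have := hd'.next_unique (h _ _ hz) ((hdu _ _).2 ⟨_, rfl, rfl⟩)
      rw [this] at hz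
      push_cast
      simpa [add_assoc] using hz
  funext i j
  refine propext ⟨h i j, fun hij => ?_⟩
  obtain ⟨t, rfl, rfl⟩ := (hdu _ _).1 hij
  have := key (t - a).val
  simpa using this

/-- In a cycle, every vertex has as many incoming as outgoing edges. -/
lemma sum_out_eq_sum_in (h : IsCycleOf E c) (j : Fin n) :
    (∑ l, if c j l then (1 : ℝ) else 0) = ∑ i, if c i j then (1 : ℝ) else 0 := by
  obtain ⟨m, v, hv, -, hc⟩ := h
  have out (l : Fin n) : (if c j l then (1 : ℝ) else 0)
      = ∑ t, if v t = j ∧ v (t + 1) = l then (1 : ℝ) else 0 := by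
    split_ifs with hjl
    · obtain ⟨t, h1, h2⟩ := (hc _ _).1 hjl
      rw [Finset.sum_eq_single t, if_pos ⟨h1, h2⟩]
      · intro s _ hs
        exact if_neg fun h' => hs (hv (h'.1.trans h1.symm))
      · simp
    · exact (Finset.sum_eq_zero fun t _ => if_neg fun h' => hjl ((hc _ _).2 ⟨t, h'⟩)).symm
  have inn (i : Fin n) : (if c i j then (1 : ℝ) else 0)
      = ∑ t, if v t = i ∧ v (t + 1) = j then (1 : ℝ) else 0 := by
    split_ifs with hij
    · obtain ⟨t, h1, h2⟩ := (hc _ _).1 hij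
      rw [Finset.sum_eq_single t, if_pos ⟨h1, h2⟩]
      · intro s _ hs
        exact if_neg fun h' => hs (hv (h'.1.trans h1.symm))
      · simp
    · exact (Finset.sum_eq_zero fun t _ => if_neg fun h' => hij ((hc _ _).2 ⟨t, h'⟩)).symm
  simp_rw [out, inn]
  rw [Finset.sum_comm,
    Finset.sum_comm (f := fun i t => if v t = i ∧ v (t + 1) = j then (1 : ℝ) else 0)]
  simp_rw [ite_and]
  simp only [Finset.sum_ite_irrel, Finset.sum_ite_eq, Finset.mem_univ, if_true,
    Finset.sum_const_zero]
  exact (Equiv.sum_comp (Equiv.addRight (1 : Fin (m + 2)))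
    (fun t => if v t = j then (1 : ℝ) else 0)).symm

end IsCycleOf

/-- A nonempty loopless digraph in which no walk gets stuck contains a cycle. -/
lemma exists_isCycleOf {n : ℕ} {H : Fin n → Fin n → Prop} (hirr : ∀ i, ¬ H i i)
    (hnext : ∀ i j, H i j → ∃ k, H j k) (hne : ∃ i j, H i j) : ∃ c, IsCycleOf H c := by
  obtain ⟨i₀, hi₀⟩ := hne
  choose! f hf using fun i (h : ∃ j, H i j) => h
  have hit : ∀ k : ℕ, ∃ j, H (f^[k] i₀) j := by
    intro k
    induction k with
    | zero => exact hi₀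
    | succ k ih =>
      rw [Function.iterate_succ_apply']
      exact hnext _ _ (hf _ ih)
  obtain ⟨a, b, hab, he⟩ := Finite.exists_ne_map_eq_of_infinite fun k : ℕ => f^[k] i₀
  wlog hlt : a < b generalizing a b
  · exact this b a hab.symm he.symm (by omega)
  set y := f^[a] i₀ with hy
  have hper : Function.IsPeriodicPt f (b - a) y := by
    change f^[b - a] y = y
    rw [hy, ← Function.iterate_add_apply, Nat.sub_add_cancel hlt.le]
    exact he.symm
  have hH : ∀ k, H (f^[k] y) (f^[k + 1] y) := by
    intro k
    rw [Function.iterate_succ_apply', hy, ← Function.iterate_add_apply]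
    exact hf _ (hit _)
  have hpos : 0 < Function.minimalPeriod f y := hper.minimalPeriod_pos (by omega)
  have hne1 : Function.minimalPeriod f y ≠ 1 := by
    intro h1
    have := Function.minimalPeriod_eq_one_iff_isFixedPt.1 h1
    have h0 := hH 0
    simp only [Function.iterate_zero, id, zero_add, Function.iterate_one] at h0
    rw [this] at h0
    exact hirr _ h0
  obtain ⟨m, hm⟩ : ∃ m, Function.minimalPeriod f y = m + 2 := ⟨Function.minimalPeriod f y - 2, by omega⟩
  have hadd : ∀ t : Fin (m + 2), f^[(t + 1).val] y = f^[t.val + 1] y := by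
    intro t
    have h := Function.iterate_mod_minimalPeriod_eq (f := f) (x := y) (n := t.val + 1)
    rw [hm] at h
    rw [Fin.val_add, Fin.val_one, h]
  refine ⟨fun i j => ∃ t : Fin (m + 2), f^[t.val] y = i ∧ f^[(t + 1).val] y = j, m,
    fun t => f^[t.val] y, ?_, ?_, fun _ _ => Iff.rfl⟩
  · intro s t hst
    refine Fin.ext (Function.iterate_injOn_Iio_minimalPeriod (f := f) (x := y) ?_ ?_ hst)
    · simp [hm]
    · simp [hm]
  · intro t
    simpa only [hadd] using hH t

/-- The digraph of nonzero off-diagonal entries of a matrix. -/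
def offDiagSupport {n : ℕ} (A : Matrix (Fin n) (Fin n) ℝ) (i j : Fin n) : Prop :=
  i ≠ j ∧ A i j ≠ 0

section Spectral

variable {n : ℕ} {A : Matrix (Fin n) (Fin n) ℝ} {w : Fin n → ℝ}

lemma IsISM.mulVec_one (hA : IsISM A) : A *ᵥ (fun _ => 1) = 0 := by
  funext i
  simpa [mulVec, dotProduct] using hA.2 i

/-- Maximum principle: harmonic vectors of an irreducible ISM are constant. -/
lemma IsISM.eq_of_mulVec_eq_zero (hA : IsISM A)
    (hconn : ∀ i j, Relation.ReflTransGen (offDiagSupport A) i j) {x : Fin n → ℝ}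
    (hx : A *ᵥ x = 0) (i j : Fin n) : x i = x j := by
  obtain ⟨r, -, hr⟩ := Finset.exists_max_image Finset.univ x ⟨i, Finset.mem_univ i⟩
  have hmax : ∀ k, x k = x r := by
    intro k
    induction hconn r k with
    | refl => rfl
    | @tail a b _ hab ih =>
      have hsum : ∑ l, A a l * (x a - x l) = 0 := by
        have h1 : ∑ l, A a l * x l = 0 := congrFun hx a
        simp_rw [mul_sub, Finset.sum_sub_distrib, ← Finset.sum_mul, hA.2 a, h1]
        simp
      have hterm := (Finset.sum_eq_zero_iff_of_nonneg (fun l _ => ?_)).1 hsum b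
        (Finset.mem_univ b)
      · have := (mul_eq_zero.1 hterm).resolve_left hab.2
        linarith
      · by_cases hal : a = l
        · simp [hal]
        · refine mul_nonneg (hA.1 a l hal) ?_
          rw [ih]
          linarith [hr l (Finset.mem_univ l)]
  rw [hmax i, hmax j]

lemma simpleZeroEig_iff_finrank : SimpleZeroEig A ↔
    Module.finrank ℝ (Module.End.maxGenEigenspace (Matrix.toLin' A) 0) = 1 := by
  rw [LinearMap.finrank_maxGenEigenspace_eq, Matrix.charpoly_toLin', SimpleZeroEig]

lemma IsISM.simpleZeroEig (hn : 0 < n) (hA : IsISM A) (hw : ∀ i, 0 < w i) (hb : Aᵀ *ᵥ w = 0)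
    (hconn : ∀ i j, Relation.ReflTransGen (offDiagSupport A) i j) : SimpleZeroEig A := by
  have hdot : ∀ x, w ⬝ᵥ (A *ᵥ x) = 0 := by
    intro x
    rw [dotProduct_mulVec, ← mulVec_transpose, hb, zero_dotProduct]
  have hker : ∀ (k : ℕ) (x : Fin n → ℝ), ((Matrix.toLin' A) ^ k) x = 0 → A *ᵥ x = 0 := by
    intro k
    induction k with
    | zero =>
      intro x hx
      have : x = 0 := by simpa using hx
      simp [this]
    | succ k ih =>
      intro x hx
      rw [pow_succ, Module.End.mul_apply, Matrix.toLin'_apply] at hx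
      have h2 := hA.eq_of_mulVec_eq_zero hconn (ih _ hx)
      funext i
      have h3 := hdot x
      simp only [dotProduct] at h3
      rw [Finset.sum_congr rfl fun l _ => by rw [h2 l i], ← Finset.sum_mul] at h3
      refine (mul_eq_zero.1 h3).resolve_left (ne_of_gt ?_)
      exact Finset.sum_pos (fun l _ => hw l) ⟨i, Finset.mem_univ i⟩
  rw [simpleZeroEig_iff_finrank]
  have hone : (fun _ => 1 : Fin n → ℝ) ∈ Module.End.maxGenEigenspace (Matrix.toLin' A) 0 := by
    rw [Module.End.mem_maxGenEigenspace]
    exact ⟨1, by simpa using hA.mulVec_one⟩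
  refine finrank_eq_one (⟨_, hone⟩ : Module.End.maxGenEigenspace (Matrix.toLin' A) 0) ?_ ?_
  · intro h
    have := congrFun (congrArg Subtype.val h) ⟨0, hn⟩
    simp at this
  · rintro ⟨x, hx⟩
    obtain ⟨k, hk⟩ := (Module.End.mem_maxGenEigenspace _ _ _).1 hx
    have hx0 := hker k x (by simpa using hk)
    refine ⟨x ⟨0, hn⟩, Subtype.ext (funext fun i => ?_)⟩
    simpa using hA.eq_of_mulVec_eq_zero hconn hx0 ⟨0, hn⟩ i

lemma sum_weight_mul_col_eq_zero (hb : Aᵀ *ᵥ w = 0) (j : Fin n) : ∑ i, w i * A i j = 0 := by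
  have := congrFun hb j
  simpa [mulVec, dotProduct, mul_comm] using this

/-- If no edge leaves `R`, then no edge enters `R`. -/
lemma IsISM.eq_zero_of_closed (hA : IsISM A) (hw : ∀ i, 0 < w i) (hb : Aᵀ *ᵥ w = 0)
    {R : Fin n → Prop} (hR : ∀ i j, R i → ¬ R j → A i j = 0) {i j : Fin n} (hi : ¬ R i)
    (hj : R j) : A i j = 0 := by
  have hrow : ∀ a, R a → ∑ b, (if R b then w a * A a b else 0) = 0 := by
    intro a ha
    have h1 : ∑ b, w a * A a b = 0 := by rw [← Finset.mul_sum, hA.2 a, mul_zero]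
    refine Eq.trans ?_ h1
    refine Finset.sum_congr rfl fun b _ => ?_
    split_ifs with hb
    · rfl
    · simp [hR a b ha hb]
  have htot : ∑ a, ∑ b, (if ¬ R a ∧ R b then w a * A a b else 0) = 0 := by
    have h2 : ∑ a, ∑ b, (if R b then w a * A a b else 0) = 0 := by
      rw [Finset.sum_comm]
      refine Finset.sum_eq_zero fun b _ => ?_
      split_ifs
      · exact sum_weight_mul_col_eq_zero hb b
      · simp
    refine Eq.trans ?_ h2
    refine Finset.sum_congr rfl fun a _ => ?_
    by_cases ha : R a
    · simp [ha, hrow a ha]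
    · simp [ha]
  have hnn : ∀ a b, 0 ≤ if ¬ R a ∧ R b then w a * A a b else 0 := by
    intro a b
    split_ifs with h
    · refine mul_nonneg (hw a).le (hA.1 a b ?_)
      rintro rfl
      exact h.1 h.2
    · exact le_rfl
  have h3 := (Finset.sum_eq_zero_iff_of_nonneg
    (fun a _ => Finset.sum_nonneg fun b _ => hnn a b)).1 htot i (Finset.mem_univ i)
  have h4 := (Finset.sum_eq_zero_iff_of_nonneg (fun b _ => hnn i b)).1 h3 j (Finset.mem_univ j)
  rw [if_pos ⟨hi, hj⟩] at h4
  exact (mul_eq_zero.1 h4).resolve_left (hw i).ne'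

lemma IsISM.connected_of_simpleZeroEig (hA : IsISM A) (hw : ∀ i, 0 < w i) (hb : Aᵀ *ᵥ w = 0)
    (hs : SimpleZeroEig A) (i j : Fin n) : Relation.ReflTransGen (offDiagSupport A) i j := by
  by_contra hij
  set R : Fin n → Prop := Relation.ReflTransGen (offDiagSupport A) i with hRdef
  have hout : ∀ a b, R a → ¬ R b → A a b = 0 := by
    intro a b ha hb'
    by_contra h0
    exact hb' (ha.tail ⟨fun h => hb' (h ▸ ha), h0⟩)
  have hin : ∀ a b, ¬ R a → R b → A a b = 0 := fun a b ha hb' =>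
    hA.eq_zero_of_closed hw hb hout ha hb'
  set x : Fin n → ℝ := fun a => if R a then 1 else 0 with hx
  have hAx : A *ᵥ x = 0 := by
    funext a
    simp only [mulVec, dotProduct, Pi.zero_apply, hx]
    by_cases ha : R a
    · rw [← hA.2 a]
      refine Finset.sum_congr rfl fun b _ => ?_
      by_cases hb' : R b
      · simp [hb']
      · simp [hb', hout a b ha hb']
    · refine Finset.sum_eq_zero fun b _ => ?_
      by_cases hb' : R b
      · simp [hin a b ha hb']
      · simp [hb']
  rw [simpleZeroEig_iff_finrank] at hs
  have hmem : ∀ y, A *ᵥ y = 0 → y ∈ Module.End.maxGenEigenspace (Matrix.toLin' A) 0 := by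
    intro y hy
    rw [Module.End.mem_maxGenEigenspace]
    exact ⟨1, by simpa using hy⟩
  obtain ⟨⟨v, hv⟩, -, hspan⟩ := finrank_eq_one_iff'.1 hs
  obtain ⟨a, ha⟩ := hspan ⟨_, hmem _ hA.mulVec_one⟩
  obtain ⟨b, hb'⟩ := hspan ⟨_, hmem _ hAx⟩
  have ha' : ∀ l, a * v l = 1 := fun l => congrFun (congrArg Subtype.val ha) l
  have hb'' : ∀ l, b * v l = x l := fun l => congrFun (congrArg Subtype.val hb') l
  have hxi : x i = 1 := if_pos Relation.ReflTransGen.refl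
  have hxj : x j = 0 := if_neg hij
  have h1 := hb'' i
  have h2 := hb'' j
  rw [hxi] at h1
  rw [hxj] at h2
  have hvj : v j ≠ 0 := fun h => by simpa [h] using ha' j
  have hb0 := (mul_eq_zero.1 h2).resolve_right hvj
  simp [hb0] at h1

end Spectral

section CycleISM

variable {n : ℕ} {E c : Fin n → Fin n → Prop} {w : Fin n → ℝ}

lemma cycleISM_apply_of_ne {i j : Fin n} (hij : i ≠ j) :
    cycleISM w c i j = if c i j then (w i)⁻¹ else 0 := by
  simp [cycleISM, hij]

lemma sum_cycleISM_row (i : Fin n) : ∑ j, cycleISM w c i j = 0 := by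
  rw [← Finset.add_sum_erase _ _ (Finset.mem_univ i)]
  have h : ∑ j ∈ Finset.univ.erase i, cycleISM w c i j
      = ∑ j ∈ Finset.univ.erase i, if c i j then (w i)⁻¹ else 0 :=
    Finset.sum_congr rfl fun j hj => cycleISM_apply_of_ne (Finset.ne_of_mem_erase hj).symm
  rw [h]
  simp [cycleISM]

lemma isISM_cycleISM (hw : ∀ i, 0 < w i) : IsISM (cycleISM w c) := by
  refine ⟨fun i j hij => ?_, sum_cycleISM_row⟩
  rw [cycleISM_apply_of_ne hij]
  split_ifs
  · exact (inv_pos.2 (hw i)).le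
  · exact le_rfl

lemma IsCycleOf.transpose_cycleISM_mulVec (hc : IsCycleOf E c) (hE : ∀ i, ¬ E i i)
    (hw : ∀ i, 0 < w i) : (cycleISM w c)ᵀ *ᵥ w = 0 := by
  have hcc : ∀ i, ¬ c i i := fun i h => hE i (hc.edge h)
  funext j
  simp only [mulVec, dotProduct, transpose_apply, Pi.zero_apply]
  have h1 : ∀ i, cycleISM w c i j * w i = (if c i j then (1 : ℝ) else 0)
      - if i = j then ∑ l, if c j l then (1 : ℝ) else 0 else 0 := by
    intro i
    by_cases hij : i = j
    · subst hij
      have h2 : ∑ l ∈ Finset.univ.erase i, (if c i l then (w i)⁻¹ else 0)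
          = ∑ l, if c i l then (w i)⁻¹ else 0 := by
        rw [← Finset.add_sum_erase _ _ (Finset.mem_univ i), if_neg (hcc i), zero_add]
      simp only [cycleISM, of_apply, if_true, h2, if_neg (hcc i), zero_sub, neg_mul,
        Finset.sum_mul, ite_mul, zero_mul, inv_mul_cancel₀ (hw i).ne']
    · rw [cycleISM_apply_of_ne hij, if_neg hij, sub_zero]
      split_ifs
      · exact inv_mul_cancel₀ (hw i).ne'
      · exact zero_mul _
  simp_rw [h1, Finset.sum_sub_distrib]
  simp [← hc.sum_out_eq_sum_in j]

lemma eq_zero_of_offDiag_eq_zero {A : Matrix (Fin n) (Fin n) ℝ} (hA : IsISM A)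
    (h : ∀ i j, i ≠ j → A i j = 0) : A = 0 := by
  ext i j
  by_cases hij : i = j
  · subst hij
    have := hA.2 i
    rwa [Finset.sum_eq_single i (fun b _ hb => h i b hb.symm) (by simp)] at this
  · exact h i j hij

lemma offDiagSupport_next {A : Matrix (Fin n) (Fin n) ℝ} (hA : IsISM A) (hw : ∀ i, 0 < w i)
    (hb : Aᵀ *ᵥ w = 0) {i j : Fin n} (hij : offDiagSupport A i j) :
    ∃ k, offDiagSupport A j k := by
  by_contra! hno
  refine hij.2 (hA.eq_zero_of_closed hw hb (R := (· = j)) ?_ hij.1 rfl)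
  rintro a b rfl hba
  by_contra h0
  exact hno b ⟨fun h => hba h.symm, h0⟩

end CycleISM

section Combinations

variable {n k : ℕ} {E : Fin n → Fin n → Prop} {w : Fin n → ℝ} {Gc : Fin k → Fin n → Fin n → Prop}
  {S : Finset (Fin k)} {α : Fin k → ℝ} {A : Matrix (Fin n) (Fin n) ℝ}

lemma sum_smul_cycleISM_apply {i j : Fin n} (hij : i ≠ j) :
    (∑ s ∈ S, α s • cycleISM w (Gc s)) i j = ∑ s ∈ S, if Gc s i j then α s * (w i)⁻¹ else 0 := by
  simp only [Matrix.sum_apply, Matrix.smul_apply, cycleISM_apply_of_ne hij, smul_eq_mul, mul_ite,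
    mul_zero]

lemma isISM_sum_smul_cycleISM (hw : ∀ i, 0 < w i) (hα : ∀ s ∈ S, 0 ≤ α s) :
    IsISM (∑ s ∈ S, α s • cycleISM w (Gc s)) := by
  constructor
  · intro i j hij
    rw [sum_smul_cycleISM_apply hij]
    refine Finset.sum_nonneg fun s hs => ?_
    split_ifs
    · exact mul_nonneg (hα s hs) (inv_pos.2 (hw i)).le
    · exact le_rfl
  · intro i
    simp only [Matrix.sum_apply, Matrix.smul_apply]
    rw [Finset.sum_comm]
    exact Finset.sum_eq_zero fun s _ => by rw [← Finset.smul_sum, sum_cycleISM_row, smul_zero]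

lemma transpose_sum_smul_cycleISM_mulVec (hE : ∀ i, ¬ E i i) (hw : ∀ i, 0 < w i)
    (hcyc : ∀ t, IsCycleOf E (Gc t)) :
    (∑ s ∈ S, α s • cycleISM w (Gc s))ᵀ *ᵥ w = 0 := by
  rw [Matrix.transpose_sum, Matrix.sum_mulVec]
  refine Finset.sum_eq_zero fun s _ => ?_
  rw [Matrix.transpose_smul, Matrix.smul_mulVec, (hcyc s).transpose_cycleISM_mulVec hE hw,
    smul_zero]

lemma offDiagSupport_iff_of_mem_coOpen (hE : ∀ i, ¬ E i i) (hw : ∀ i, 0 < w i)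
    (hcyc : ∀ t, IsCycleOf E (Gc t)) (hA : A ∈ coOpen (fun t => cycleISM w (Gc t)) S)
    (i j : Fin n) : offDiagSupport A i j ↔ ∃ s ∈ S, Gc s i j := by
  obtain ⟨α, hα, rfl⟩ := hA
  constructor
  · rintro ⟨hij, h0⟩
    rw [sum_smul_cycleISM_apply hij] at h0
    obtain ⟨s, hs, hs0⟩ := Finset.exists_ne_zero_of_sum_ne_zero h0
    exact ⟨s, hs, by_contra fun h => hs0 (if_neg h)⟩
  · rintro ⟨s, hs, hsij⟩
    have hij : i ≠ j := by
      rintro rfl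
      exact hE i ((hcyc s).edge hsij)
    refine ⟨hij, ?_⟩
    rw [sum_smul_cycleISM_apply hij]
    refine (Finset.sum_pos' (fun t ht => ?_) ⟨s, hs, ?_⟩).ne'
    · split_ifs
      · exact mul_nonneg (hα t ht).le (inv_pos.2 (hw i)).le
      · exact le_rfl
    · rw [if_pos hsij]
      exact mul_pos (hα s hs) (inv_pos.2 (hw i))

/-- Conformal decomposition: a balanced ISM is a nonnegative combination of cycle ISMs. -/
lemma exists_nonneg_eq_sum_cycleISM (hE : ∀ i, ¬ E i i) (hw : ∀ i, 0 < w i)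
    (hall : ∀ c, IsCycleOf E c → ∃ t, Gc t = c)
    (hA : IsISM A) (hp : InPattern E A) (hb : Aᵀ *ᵥ w = 0) :
    ∃ α : Fin k → ℝ, (∀ t, 0 ≤ α t) ∧ A = ∑ t, α t • cycleISM w (Gc t) := by
  induction hN : (Finset.univ.filter fun p : Fin n × Fin n => offDiagSupport A p.1 p.2).card
    using Nat.strong_induction_on generalizing A with
  | _ N ih =>
    by_cases hne : ∃ i j, offDiagSupport A i j
    · obtain ⟨c, hc⟩ := exists_isCycleOf (fun i h => h.1 rfl)
        (fun i j => offDiagSupport_next hA hw hb) hne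
      have hcE : IsCycleOf E c := hc.mono fun i j h => by_contra fun h' => h.2 (hp i j h.1 h')
      obtain ⟨t, rfl⟩ := hall c hcE
      obtain ⟨p, hp', hmin⟩ := Finset.exists_min_image
        (Finset.univ.filter fun p : Fin n × Fin n => Gc t p.1 p.2) (fun p => w p.1 * A p.1 p.2)
        (by
          obtain ⟨i, j, hij⟩ := hc.nonempty
          exact ⟨(i, j), by simpa using hij⟩)
      simp only [Finset.mem_filter, Finset.mem_univ, true_and] at hp' hmin
      set m := w p.1 * A p.1 p.2 with hm
      have hpE := hc.edge hp'
      have hm0 : 0 ≤ m := mul_nonneg (hw _).le (hA.1 _ _ hpE.1)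
      set B := A - m • cycleISM w (Gc t) with hB
      have hBij : ∀ i j, i ≠ j → B i j = A i j - if Gc t i j then m * (w i)⁻¹ else 0 := by
        intro i j hij
        simp [hB, cycleISM_apply_of_ne hij]
      have hBsupp : ∀ i j, offDiagSupport B i j → offDiagSupport A i j := by
        rintro i j ⟨hij, h0⟩
        by_cases hG : Gc t i j
        · exact hc.edge hG
        · rw [hBij i j hij, if_neg hG, sub_zero] at h0
          exact ⟨hij, h0⟩
      have hBISM : IsISM B := by
        refine ⟨fun i j hij => ?_, fun i => ?_⟩
        · rw [hBij i j hij]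
          split_ifs with hG
          · have h1 := hmin (i, j) hG
            rw [sub_nonneg, mul_inv_le_iff₀ (hw i), mul_comm (A i j)]
            exact h1
          · simpa using hA.1 i j hij
        · simp [hB, ← Finset.mul_sum, hA.2 i, sum_cycleISM_row]
      have hBp : InPattern E B := by
        intro i j hij hEij
        rw [hBij i j hij, hp i j hij hEij, if_neg fun h => hEij (hcE.edge h), sub_zero]
      have hBb : Bᵀ *ᵥ w = 0 := by
        rw [hB, Matrix.transpose_sub, Matrix.transpose_smul, Matrix.sub_mulVec,
          Matrix.smul_mulVec, hb, hcE.transpose_cycleISM_mulVec hE hw, smul_zero, sub_zero]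
      have hcard : (Finset.univ.filter fun q : Fin n × Fin n => offDiagSupport B q.1 q.2).card
          < N := by
        rw [← hN]
        refine Finset.card_lt_card (Finset.ssubset_iff_of_subset ?_ |>.2 ⟨p, ?_, ?_⟩)
        · intro q hq
          simp only [Finset.mem_filter, Finset.mem_univ, true_and] at hq ⊢
          exact hBsupp _ _ hq
        · simpa using hpE
        · simp only [Finset.mem_filter, Finset.mem_univ, true_and]
          intro h
          apply h.2
          rw [hBij _ _ h.1, if_pos hp', hm, mul_comm (w p.1), mul_inv_cancel_right₀ (hw _).ne',
            sub_self]
      obtain ⟨α, hα, hBα⟩ := ih _ hcard hBISM hBp hBb rfl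
      refine ⟨fun s => α s + if s = t then m else 0, fun s => ?_, ?_⟩
      · refine add_nonneg (hα s) ?_
        split_ifs
        · exact hm0
        · exact le_rfl
      · simp only [add_smul, Finset.sum_add_distrib, ite_smul, zero_smul, Finset.sum_ite_eq',
          Finset.mem_univ, if_true]
        rw [← hBα, hB, sub_add_cancel]
    · refine ⟨0, fun _ => le_rfl, ?_⟩
      simp only [Pi.zero_apply, zero_smul, Finset.sum_const_zero]
      refine eq_zero_of_offDiag_eq_zero hA fun i j hij => ?_
      by_contra h0
      exact hne ⟨i, j, hij, h0⟩

/-- The indices of all cycles contained in the off-diagonal support of `A`. -/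
def supportCycles (Gc : Fin k → Fin n → Fin n → Prop) (A : Matrix (Fin n) (Fin n) ℝ) :
    Finset (Fin k) :=
  Finset.univ.filter fun t => ∀ i j, Gc t i j → offDiagSupport A i j

lemma mem_supportCycles {t : Fin k} :
    t ∈ supportCycles Gc A ↔ ∀ i j, Gc t i j → offDiagSupport A i j := by
  simp [supportCycles]

lemma mem_coOpen_supportCycles (hE : ∀ i, ¬ E i i) (hw : ∀ i, 0 < w i)
    (hcyc : ∀ t, IsCycleOf E (Gc t)) (hall : ∀ c, IsCycleOf E c → ∃ t, Gc t = c)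
    (hA : IsISM A) (hp : InPattern E A) (hb : Aᵀ *ᵥ w = 0) :
    A ∈ coOpen (fun t => cycleISM w (Gc t)) (supportCycles Gc A) := by
  set D := ∑ t ∈ supportCycles Gc A, (1 : ℝ) • cycleISM w (Gc t) with hD
  have hDsupp := offDiagSupport_iff_of_mem_coOpen (A := D) hE hw hcyc
    ⟨fun _ => 1, fun _ _ => one_pos, rfl⟩
  have hDA : ∀ i j, i ≠ j → A i j = 0 → D i j = 0 := by
    intro i j hij h0
    by_contra h
    obtain ⟨s, hs, hsij⟩ := (hDsupp i j).1 ⟨hij, h⟩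
    exact (mem_supportCycles.1 hs _ _ hsij).2 h0
  have hDISM : IsISM D := isISM_sum_smul_cycleISM hw fun _ _ => zero_le_one
  obtain ⟨ε, hε, hεle⟩ : ∃ ε : ℝ, 0 < ε ∧ ∀ i j, i ≠ j → ε * D i j ≤ A i j := by
    have h : ∀ᶠ ε : ℝ in nhdsWithin 0 (Set.Ioi 0), ∀ i j, i ≠ j → ε * D i j ≤ A i j := by
      rw [Filter.eventually_all]
      intro i
      rw [Filter.eventually_all]
      intro j
      by_cases h0 : A i j = 0
      · exact Filter.Eventually.of_forall fun ε hij => by rw [hDA i j hij h0, h0, mul_zero]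
      · by_cases hij : i = j
        · exact Filter.Eventually.of_forall fun ε h => absurd hij h
        have hpos : 0 < A i j := lt_of_le_of_ne (hA.1 i j hij) (Ne.symm h0)
        have hlim : Filter.Tendsto (fun ε : ℝ => ε * D i j) (nhds 0) (nhds 0) := by
          exact (continuous_id.mul continuous_const).tendsto' _ _ (zero_mul _)
        exact ((hlim.mono_left nhdsWithin_le_nhds).eventually_lt_const hpos).mono
          fun ε h _ => h.le
    obtain ⟨ε, h, hε⟩ := (h.and self_mem_nhdsWithin).exists
    exact ⟨ε, hε, h⟩
  obtain ⟨β, hβ, hB⟩ := exists_nonneg_eq_sum_cycleISM (A := A - ε • D) hE hw hall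
    ⟨fun i j hij => by simpa using hεle i j hij, fun i => by
      simp only [Matrix.sub_apply, Matrix.smul_apply, Finset.sum_sub_distrib, ← Finset.smul_sum,
        hA.2 i, hDISM.2 i, smul_zero, sub_zero]⟩
    (fun i j hij h => by simp [hp i j hij h, hDA i j hij (hp i j hij h)])
    (by rw [Matrix.transpose_sub, Matrix.transpose_smul, Matrix.sub_mulVec, Matrix.smul_mulVec, hb,
      hD, transpose_sum_smul_cycleISM_mulVec hE hw hcyc, smul_zero, sub_zero])
  have hβ0 : ∀ t, t ∉ supportCycles Gc A → β t = 0 := by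
    intro t ht
    by_contra h0
    refine ht (mem_supportCycles.2 fun i j hij => ?_)
    have hne : i ≠ j := by
      rintro rfl
      exact hE i ((hcyc t).edge hij)
    refine ⟨hne, fun hA0 => ?_⟩
    have h1 := congrFun (congrFun hB i) j
    rw [sum_smul_cycleISM_apply hne] at h1
    simp only [Matrix.sub_apply, Matrix.smul_apply, hA0, hDA i j hne hA0, smul_zero,
      sub_zero] at h1
    have h2 := (Finset.sum_eq_zero_iff_of_nonneg (fun s _ => ?_)).1 h1.symm t (Finset.mem_univ t)
    · rw [if_pos hij] at h2
      exact h0 ((mul_eq_zero.1 h2).resolve_right (inv_pos.2 (hw i)).ne')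
    · split_ifs
      · exact mul_nonneg (hβ s) (inv_pos.2 (hw i)).le
      · exact le_rfl
  refine ⟨fun t => ε + β t, fun t _ => add_pos_of_pos_of_nonneg hε (hβ t), ?_⟩
  simp only [add_smul, Finset.sum_add_distrib]
  rw [Finset.sum_subset (f := fun t => β t • cycleISM w (Gc t)) (Finset.subset_univ _)
    (fun t _ ht => by rw [hβ0 t ht, zero_smul]), ← hB, ← Finset.smul_sum]
  simp [hD]

/-- Cycle ISMs span extreme rays, so `coOpen` of a set of cycles determines that set. -/
lemma subset_of_coOpen_subset (hE : ∀ i, ¬ E i i) (hw : ∀ i, 0 < w i)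
    (hcyc : ∀ t, IsCycleOf E (Gc t)) (hinj : Function.Injective Gc) {T : Finset (Fin k)}
    (h : coOpen (fun t => cycleISM w (Gc t)) T ⊆ coOpen (fun t => cycleISM w (Gc t)) S) :
    T ⊆ S := by
  intro t ht
  by_contra htS
  have hout : ∀ s : Fin k, ∃ p : Fin n × Fin n, s ∈ S → Gc s p.1 p.2 ∧ ¬ Gc t p.1 p.2 := by
    intro s
    by_contra! hcon
    have hs : s ∈ S := by
      obtain ⟨i, j, -⟩ := (hcyc s).nonempty
      exact (hcon (i, j)).1
    refine htS (hinj ((hcyc s).eq_of_subset (hcyc t) fun i j hij => ?_) ▸ hs)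
    exact (hcon (i, j)).2 hij
  choose e he using hout
  set D := ∑ s ∈ T, (1 : ℝ) • cycleISM w (Gc s) with hD
  set M := ∑ s ∈ S, w (e s).1 * D (e s).1 (e s).2 with hM
  have hDnn : ∀ i j, i ≠ j → 0 ≤ D i j :=
    (isISM_sum_smul_cycleISM hw fun _ _ => zero_le_one).1
  have hne : ∀ s i j, Gc s i j → i ≠ j := by
    rintro s i j hij rfl
    exact hE i ((hcyc s).edge hij)
  have hM0 : 0 ≤ M := Finset.sum_nonneg fun s hs =>
    mul_nonneg (hw _).le (hDnn _ _ (hne s _ _ (he s hs).1))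
  have hmem : D + (M + 1) • cycleISM w (Gc t) ∈ coOpen (fun t => cycleISM w (Gc t)) T := by
    refine ⟨fun s => 1 + if s = t then M + 1 else 0, fun s _ => ?_, ?_⟩
    · dsimp only
      split_ifs <;> linarith
    · simp [hD, add_smul, Finset.sum_add_distrib, ht]
  obtain ⟨α, hα, hX⟩ := h hmem
  have hXij : ∀ i j, i ≠ j → D i j + (if Gc t i j then (M + 1) * (w i)⁻¹ else 0)
      = ∑ s ∈ S, if Gc s i j then α s * (w i)⁻¹ else 0 := by
    intro i j hij
    have h1 := congrFun (congrFun hX i) j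
    rw [sum_smul_cycleISM_apply hij] at h1
    rw [← h1]
    simp [cycleISM_apply_of_ne hij]
  have hnn : ∀ i j, ∀ s ∈ S, 0 ≤ if Gc s i j then α s * (w i)⁻¹ else 0 := by
    intro i j s hs
    split_ifs
    · exact mul_nonneg (hα s hs).le (inv_pos.2 (hw i)).le
    · exact le_rfl
  have hαle : ∀ s ∈ S, α s ≤ w (e s).1 * D (e s).1 (e s).2 := by
    intro s hs
    have h1 := hXij _ _ (hne s _ _ (he s hs).1)
    rw [if_neg (he s hs).2, add_zero] at h1
    have h2 := Finset.single_le_sum (hnn (e s).1 (e s).2) hs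
    rw [← h1, if_pos (he s hs).1, mul_inv_le_iff₀ (hw _)] at h2
    linarith
  obtain ⟨i, j, hij⟩ := (hcyc t).nonempty
  have h1 := hXij i j (hne t i j hij)
  rw [if_pos hij] at h1
  have h2 : ∑ s ∈ S, (if Gc s i j then α s * (w i)⁻¹ else 0) ≤ M * (w i)⁻¹ := by
    rw [hM, Finset.sum_mul]
    refine Finset.sum_le_sum fun s hs => ?_
    have h3 : α s * (w i)⁻¹ ≤ w (e s).1 * D (e s).1 (e s).2 * (w i)⁻¹ :=
      mul_le_mul_of_nonneg_right (hαle s hs) (inv_pos.2 (hw i)).le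
    split_ifs
    · exact h3
    · exact (mul_pos (hα s hs) (inv_pos.2 (hw i))).le.trans h3
  have h4 := hDnn i j (hne t i j hij)
  have h5 := inv_pos.2 (hw i)
  linarith

lemma coOpen_subset_coOpen_supportCycles (hE : ∀ i, ¬ E i i) (hw : ∀ i, 0 < w i)
    (hcyc : ∀ t, IsCycleOf E (Gc t)) (hall : ∀ c, IsCycleOf E c → ∃ t, Gc t = c)
    (hA : A ∈ coOpen (fun t => cycleISM w (Gc t)) S) :
    coOpen (fun t => cycleISM w (Gc t)) S
      ⊆ coOpen (fun t => cycleISM w (Gc t)) (supportCycles Gc A) := by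
  intro B hB
  have hAB : offDiagSupport A = offDiagSupport B := by
    funext i j
    rw [offDiagSupport_iff_of_mem_coOpen hE hw hcyc hA,
      offDiagSupport_iff_of_mem_coOpen hE hw hcyc hB]
  have hBsupp := offDiagSupport_iff_of_mem_coOpen hE hw hcyc hB
  have hcyceq : supportCycles Gc A = supportCycles Gc B := by
    ext t
    simp only [mem_supportCycles, hAB]
  obtain ⟨α, hα, rfl⟩ := hB
  rw [hcyceq]
  refine mem_coOpen_supportCycles hE hw hcyc hall
    (isISM_sum_smul_cycleISM hw fun s hs => (hα s hs).le) (fun i j hij hEij => ?_)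
    (transpose_sum_smul_cycleISM_mulVec hE hw hcyc)
  by_contra h0
  obtain ⟨s, -, hs⟩ := (hBsupp i j).1 ⟨hij, h0⟩
  exact hEij ((hcyc s).edge hs)

lemma MaximalPrincipal.eq_supportCycles (hE : ∀ i, ¬ E i i) (hw : ∀ i, 0 < w i)
    (hcyc : ∀ t, IsCycleOf E (Gc t)) (hinj : Function.Injective Gc)
    (hall : ∀ c, IsCycleOf E c → ∃ t, Gc t = c)
    (hS : MaximalPrincipal Gc (fun t => cycleISM w (Gc t)) S)
    (hA : A ∈ coOpen (fun t => cycleISM w (Gc t)) S) : S = supportCycles Gc A := by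
  have hsub := coOpen_subset_coOpen_supportCycles hE hw hcyc hall hA
  have hSsub : S ⊆ supportCycles Gc A := fun s hs => mem_supportCycles.2 fun i j hij =>
    (offDiagSupport_iff_of_mem_coOpen hE hw hcyc hA i j).2 ⟨s, hs, hij⟩
  refine hSsub.antisymm (subset_of_coOpen_subset hE hw hcyc hinj ?_)
  by_contra hnot
  refine hS.2 ⟨_, fun i j => Relation.ReflTransGen.mono ?_ _ _ (hS.1 i j), hsub, hnot⟩
  rintro a b ⟨s, hs, hab⟩
  exact ⟨s, hSsub hs, hab⟩

end Combinations

/-- Proposition 4: the sets `Co(𝒢*_1), …, Co(𝒢*_l)` attached to the maximal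
principal subsets are pairwise disjoint, and their union is `𝔸_G(w)`. -/
theorem feasible_eq_disjoint_union_maximal_principal
    (n k : ℕ) (hn : 1 < n)
    (E : Fin n → Fin n → Prop) (hsimple : ∀ i, ¬ E i i)
    (hsc : ∀ i j : Fin n, Relation.ReflTransGen E i j)
    (w : Fin n → ℝ) (hw : ∀ i, 0 < w i) (hw1 : ∑ i, w i = 1)
    (Gc : Fin k → Fin n → Fin n → Prop)
    (hcyc : ∀ t, IsCycleOf E (Gc t)) (hinj : Function.Injective Gc)
    (hall : ∀ c, IsCycleOf E c → ∃ t, Gc t = c) :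
    (∀ S₁ S₂ : Finset (Fin k),
        MaximalPrincipal Gc (fun t => cycleISM w (Gc t)) S₁ →
        MaximalPrincipal Gc (fun t => cycleISM w (Gc t)) S₂ → S₁ ≠ S₂ →
        coOpen (fun t => cycleISM w (Gc t)) S₁ ∩ coOpen (fun t => cycleISM w (Gc t)) S₂ = ∅) ∧
      {A : Matrix (Fin n) (Fin n) ℝ | Feasible E w A} =
        ⋃ (S : Finset (Fin k)) (_ : MaximalPrincipal Gc (fun t => cycleISM w (Gc t)) S),
          coOpen (fun t => cycleISM w (Gc t)) S := by
  constructor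
  · intro S₁ S₂ h₁ h₂ hne
    refine Set.eq_empty_of_forall_notMem fun A hA => hne ?_
    rw [h₁.eq_supportCycles hsimple hw hcyc hinj hall hA.1,
      h₂.eq_supportCycles hsimple hw hcyc hinj hall hA.2]
  · ext A
    simp only [Set.mem_ofPred_eq, Set.mem_iUnion, exists_prop]
    constructor
    · rintro ⟨hA, hp, hs, hb⟩
      have hmem := mem_coOpen_supportCycles hsimple hw hcyc hall hA hp hb
      refine ⟨supportCycles Gc A, ⟨fun i j => ?_, ?_⟩, hmem⟩
      · refine Relation.ReflTransGen.mono (fun a b hab => ?_) _ _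
          (hA.connected_of_simpleZeroEig hw hb hs i j)
        exact (offDiagSupport_iff_of_mem_coOpen hsimple hw hcyc hmem a b).1 hab
      · rintro ⟨S', -, hss⟩
        exact hss.2 (coOpen_subset_coOpen_supportCycles hsimple hw hcyc hall (hss.1 hmem))
    · rintro ⟨S, hS, hA⟩
      have hsupp := offDiagSupport_iff_of_mem_coOpen hsimple hw hcyc hA
      have hconn : ∀ i j, Relation.ReflTransGen (offDiagSupport A) i j := fun i j =>
        Relation.ReflTransGen.mono (fun a b hab => (hsupp a b).2 hab) _ _ (hS.1 i j)
      obtain ⟨α, hα, rfl⟩ := hA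
      have hISM := isISM_sum_smul_cycleISM (Gc := Gc) hw fun s hs => (hα s hs).le
      have hb := transpose_sum_smul_cycleISM_mulVec (S := S) (α := α) hsimple hw hcyc
      refine ⟨hISM, fun i j hij hEij => ?_, hISM.simpleZeroEig (by omega) hw hb hconn, hb⟩
      by_contra h0
      obtain ⟨s, -, hs⟩ := (hsupp i j).1 ⟨hij, h0⟩
      exact hEij ((hcyc s).edge hs)
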